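/- arXiv:1804.01303 — 2 statements merged into one kernel-verified Lean document; each statement's English description precedes it below -/
import Mathlib

section
/- Let H be a complex Hilbert space. Then the Banach space C_1(H) of trace class operators on H satisfies the λ-property, i.e., λ(a) > 0 for every a in the closed unit ball of C_1(H) (with respect to the trace norm). -/
/-! Setting: `H` is a complex Hilbert space, and we consider the space `C₁(H)` of trace class
operators on `H` (more generally the Schatten classes `C_p(H)`), regarded as those bounded
operators `a : H →L[ℂ] H` that are compact and whose sequence of singular values is
`p`-summable. The singular values `μₙ(a)` of a compact operator `a` (the eigenvalues of
`|a| = (a^* a)^(1/2)` arranged in decreasing order and repeated according to multiplicity)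
are realized here via the approximation numbers, which coincide with them. -/

/-- `sValue a n` is the `n`-th approximation number (`0`-indexed) of `a`, namely the distance
from `a` to the operators of rank at most `n`.  For a compact operator on a Hilbert space this
coincides with the `(n+1)`-th singular value `μ_{n+1}(a)`, i.e. the `(n+1)`-th eigenvalue of
`|a| = (a^* a)^(1/2)` arranged in decreasing order and repeated according to multiplicity.  In
particular `sValue a 0 = μ₁(a) = ‖a‖`. -/
noncomputable def sValue {H : Type*} [NormedAddCommGroup H] [InnerProductSpace ℂ H]
    (a : H →L[ℂ] H) (n : ℕ) : ℝ :=
  sInf {r : ℝ | ∃ F : H →L[ℂ] H, LinearMap.rank (F : H →ₗ[ℂ] H) ≤ (n : Cardinal) ∧ r = ‖a - F‖}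

/-- Membership in the Schatten class `C_p(H)`: `a` is a compact operator with
`‖a‖_p^p = ∑ₙ μₙ(a)^p < ∞`. -/
def MemSchatten {H : Type*} [NormedAddCommGroup H] [InnerProductSpace ℂ H]
    (p : ℝ) (a : H →L[ℂ] H) : Prop :=
  IsCompactOperator a ∧ Summable (fun n => sValue a n ^ p)

/-- Membership in the trace class `C₁(H)`: `a` is a compact operator with
`‖a‖₁ = tr |a| = ∑ₙ μₙ(a) < ∞`. -/
def MemTraceClass {H : Type*} [NormedAddCommGroup H] [InnerProductSpace ℂ H]
    (a : H →L[ℂ] H) : Prop :=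
  IsCompactOperator a ∧ Summable (fun n => sValue a n)

/-- The trace norm `‖a‖₁ = tr |a| = ∑ₙ μₙ(a)`. -/
noncomputable def traceNorm {H : Type*} [NormedAddCommGroup H] [InnerProductSpace ℂ H]
    (a : H →L[ℂ] H) : ℝ :=
  ∑' n, sValue a n

/-- The closed unit ball of `C₁(H)` with respect to the trace norm `‖·‖₁`. -/
def traceBall (H : Type*) [NormedAddCommGroup H] [InnerProductSpace ℂ H] :
    Set (H →L[ℂ] H) :=
  {x | MemTraceClass x ∧ traceNorm x ≤ 1}

/-- The λ-function of Aron and Lohman on the closed unit ball of `C₁(H)`: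
`λ(a) = sup { t : (e, y, t) ∈ ∂ₑ(B) × B × [0,1] is a triplet amenable to a }`,
where a triplet `(e, y, t)` is amenable to `a` when `a = t • e + (1 - t) • y`. -/
noncomputable def lambdaFn {H : Type*} [NormedAddCommGroup H] [InnerProductSpace ℂ H]
    (a : H →L[ℂ] H) : ℝ :=
  sSup {t : ℝ | t ∈ Set.Icc (0 : ℝ) 1 ∧
    ∃ e ∈ Set.extremePoints ℝ (traceBall H), ∃ y ∈ traceBall H, a = t • e + (1 - t) • y}

/-- A minimal (i.e. rank-one) partial isometry: `e e^* e = e` and `e` has rank one. -/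
def IsMinimalPartialIsometry {H : Type*} [NormedAddCommGroup H] [InnerProductSpace ℂ H]
    [CompleteSpace H] (e : H →L[ℂ] H) : Prop :=
  e ∘L (ContinuousLinearMap.adjoint e) ∘L e = e ∧ LinearMap.rank (e : H →ₗ[ℂ] H) = 1

/-- The rank one operator `η ⊗ ξ : ζ ↦ ⟨ζ, ξ⟩ η` (Mathlib's inner product being conjugate
linear in the first variable, this is `ζ ↦ ⟪ξ, ζ⟫ • η`). -/
noncomputable def rankOneOp {H : Type*} [NormedAddCommGroup H] [InnerProductSpace ℂ H]
    (η ξ : H) : H →L[ℂ] H :=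
  (innerSL ℂ ξ).smulRight η

section ApproximationNumbers

variable {H : Type*} [NormedAddCommGroup H] [InnerProductSpace ℂ H]

theorem sValue_le_norm_sub (a F : H →L[ℂ] H) {n : ℕ}
    (hF : LinearMap.rank (F : H →ₗ[ℂ] H) ≤ (n : Cardinal)) : sValue a n ≤ ‖a - F‖ :=
  csInf_le ⟨0, by rintro r ⟨G, -, rfl⟩; exact norm_nonneg _⟩ ⟨F, hF, rfl⟩

theorem le_sValue {a : H →L[ℂ] H} {n : ℕ} {c : ℝ}
    (h : ∀ F : H →L[ℂ] H, LinearMap.rank (F : H →ₗ[ℂ] H) ≤ (n : Cardinal) → c ≤ ‖a - F‖) :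
    c ≤ sValue a n :=
  le_csInf ⟨_, 0, by simp, rfl⟩ (by rintro r ⟨F, hF, rfl⟩; exact h F hF)

theorem sValue_nonneg (a : H →L[ℂ] H) (n : ℕ) : 0 ≤ sValue a n :=
  le_sValue fun _ _ => norm_nonneg _

theorem sValue_le_norm (a : H →L[ℂ] H) (n : ℕ) : sValue a n ≤ ‖a‖ := by
  simpa using sValue_le_norm_sub a 0 (n := n) (by simp)

theorem sValue_zero (a : H →L[ℂ] H) : sValue a 0 = ‖a‖ := by
  refine le_antisymm (sValue_le_norm a 0) (le_sValue fun F hF => ?_)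
  have hF0 : (F : H →ₗ[ℂ] H) = 0 := by
    rw [LinearMap.rank, Nat.cast_zero, nonpos_iff_eq_zero, Submodule.rank_eq_zero,
      LinearMap.range_eq_bot] at hF
    exact hF
  have : F = 0 := ContinuousLinearMap.coe_injective hF0
  simp [this]

theorem sValue_smul_le (c : ℝ) (a : H →L[ℂ] H) (n : ℕ) :
    sValue (c • a) n ≤ |c| * sValue a n := by
  rcases eq_or_ne c 0 with rfl | hc
  · simpa using sValue_le_norm (0 : H →L[ℂ] H) n
  · have hc' : 0 < |c| := abs_pos.2 hc
    rw [← div_le_iff₀' hc']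
    refine le_sValue fun F hF => ?_
    rw [div_le_iff₀' hc', ← Real.norm_eq_abs, ← norm_smul, smul_sub]
    refine sValue_le_norm_sub _ _ (le_trans ?_ hF)
    refine Submodule.rank_mono ?_
    rintro _ ⟨x, rfl⟩
    exact ⟨(c : ℂ) • x, by simp⟩

theorem norm_le_traceNorm {a : H →L[ℂ] H} (ha : MemTraceClass a) : ‖a‖ ≤ traceNorm a := by
  rw [← sValue_zero]
  exact ha.2.le_tsum 0 fun n _ => sValue_nonneg a n

theorem norm_add_tsum_sValue_succ {a : H →L[ℂ] H} (ha : MemTraceClass a) :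
    ‖a‖ + ∑' n, sValue a (n + 1) = traceNorm a := by
  rw [traceNorm, ha.2.tsum_eq_zero_add, sValue_zero]

@[simp]
theorem rankOneOp_apply (η ξ v : H) : rankOneOp η ξ v = inner ℂ ξ v • η := by
  simp [rankOneOp]

theorem norm_rankOneOp (η ξ : H) : ‖rankOneOp η ξ‖ = ‖ξ‖ * ‖η‖ := by
  simp [rankOneOp, ContinuousLinearMap.norm_smulRight_apply]

theorem rank_rankOneOp_le (η ξ : H) :
    LinearMap.rank (rankOneOp η ξ : H →ₗ[ℂ] H) ≤ 1 := by
  refine le_trans (Submodule.rank_mono (t := Submodule.span ℂ {η}) ?_) ?_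
  · rintro _ ⟨x, rfl⟩
    simpa using Submodule.smul_mem _ _ (Submodule.mem_span_singleton_self η)
  · simpa using rank_span_le (R := ℂ) ({η} : Set H)

theorem isCompactOperator_rankOneOp (η ξ : H) : IsCompactOperator (rankOneOp η ξ) := by
  have h : IsCompactOperator (ContinuousLinearMap.toSpanSingleton ℂ η) :=
    isCompactOperator_of_locallyCompactSpace_rng (ContinuousLinearMap.toSpanSingleton ℂ η)
  exact h.comp_clm (innerSL ℂ ξ)

theorem sValue_rankOneOp_succ (η ξ : H) (n : ℕ) : sValue (rankOneOp η ξ) (n + 1) = 0 := by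
  refine le_antisymm ?_ (sValue_nonneg _ _)
  have h := sValue_le_norm_sub (rankOneOp η ξ) (rankOneOp η ξ) (n := n + 1)
    ((rank_rankOneOp_le η ξ).trans (by exact_mod_cast Nat.le_add_left 1 n))
  simpa using h

theorem rankOneOp_mem_traceBall {η ξ : H} (hη : ‖η‖ = 1) (hξ : ‖ξ‖ = 1) :
    rankOneOp η ξ ∈ traceBall H := by
  have hmem : MemTraceClass (rankOneOp η ξ) :=
    ⟨isCompactOperator_rankOneOp η ξ,
      (summable_nat_add_iff 1).1 (by simp [sValue_rankOneOp_succ])⟩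
  refine ⟨hmem, ?_⟩
  rw [← norm_add_tsum_sValue_succ hmem]
  simp [sValue_rankOneOp_succ, norm_rankOneOp, hη, hξ]

/-- Equality in the Cauchy–Schwarz estimate `‖⟪η, a ξ⟫‖ ≤ ‖a‖`. -/
theorem apply_eq_of_inner_apply_eq_norm {a : H →L[ℂ] H} {ξ η : H} (hξ : ‖ξ‖ = 1)
    (hη : ‖η‖ = 1) (h : inner ℂ η (a ξ) = (‖a‖ : ℂ)) : a ξ = (‖a‖ : ℂ) • η := by
  have h1 : ‖a ξ‖ ≤ ‖a‖ := by simpa [hξ] using a.le_opNorm ξ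
  have h2 : ‖a ξ - (‖a‖ : ℂ) • η‖ ^ 2 = ‖a ξ‖ ^ 2 - ‖a‖ ^ 2 := by
    rw [norm_sub_sq (𝕜 := ℂ), inner_smul_right, ← inner_conj_symm, h]
    simp only [Complex.conj_ofReal, norm_smul, hη, Complex.norm_real, norm_norm, mul_one]
    rw [← Complex.ofReal_mul]
    simp only [RCLike.re_to_complex, Complex.ofReal_re]
    ring
  have h3 : ‖a ξ - (‖a‖ : ℂ) • η‖ = 0 := by
    nlinarith [norm_nonneg (a ξ), norm_nonneg (a ξ - (‖a‖ : ℂ) • η)]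
  exact sub_eq_zero.1 (norm_eq_zero.1 h3)

theorem inner_apply_of_inner_apply_eq_norm [CompleteSpace H] {a : H →L[ℂ] H} {ξ η : H}
    (hξ : ‖ξ‖ = 1) (hη : ‖η‖ = 1) (h : inner ℂ η (a ξ) = (‖a‖ : ℂ)) (v : H) :
    inner ℂ η (a v) = (‖a‖ : ℂ) * inner ℂ ξ v := by
  have hn : ‖ContinuousLinearMap.adjoint a‖ = ‖a‖ := LinearIsometryEquiv.norm_map _ a
  have h' : inner ℂ ξ (ContinuousLinearMap.adjoint a η)
      = (‖ContinuousLinearMap.adjoint a‖ : ℂ) := by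
    rw [ContinuousLinearMap.adjoint_inner_right, ← inner_conj_symm, h, hn, Complex.conj_ofReal]
  rw [← ContinuousLinearMap.adjoint_inner_left, apply_eq_of_inner_apply_eq_norm hη hξ h',
    inner_smul_left, hn, Complex.conj_ofReal]

/-- Splitting off the rank one operator belonging to a maximal singular value shifts the
sequence of approximation numbers. -/
theorem sValue_sub_rankOneOp_le [CompleteSpace H] {a : H →L[ℂ] H} {ξ η : H} (hξ : ‖ξ‖ = 1)
    (hη : ‖η‖ = 1) (h : inner ℂ η (a ξ) = (‖a‖ : ℂ)) (n : ℕ) :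
    sValue (a - ‖a‖ • rankOneOp η ξ) n ≤ sValue a (n + 1) := by
  have haξ := apply_eq_of_inner_apply_eq_norm hξ hη h
  have hηa := inner_apply_of_inner_apply_eq_norm hξ hη h
  have hξξ : inner ℂ ξ ξ = (1 : ℂ) := by simp [inner_self_eq_norm_sq_to_K, hξ]
  have hηη : inner ℂ η η = (1 : ℂ) := by simp [inner_self_eq_norm_sq_to_K, hη]
  set a' := a - ‖a‖ • rankOneOp η ξ with ha'
  have ha'v : ∀ v, a' v = a v - ((‖a‖ : ℂ) * inner ℂ ξ v) • η := fun v => by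
    simp [ha', mul_smul]
  have hproj : ∀ v, ‖v - (inner ℂ ξ v : ℂ) • ξ‖ ^ 2 = ‖v‖ ^ 2 - ‖(inner ℂ ξ v : ℂ)‖ ^ 2 :=
    fun v => by
      have h0 : inner ℂ (v - (inner ℂ ξ v : ℂ) • ξ) ((inner ℂ ξ v : ℂ) • ξ) = (0 : ℂ) := by
        rw [inner_sub_left, inner_smul_right, inner_smul_right, inner_smul_left, hξξ,
          inner_conj_symm]
        ring_nf
      have h1 := norm_add_sq_eq_norm_sq_add_norm_sq_of_inner_eq_zero _ _ h0
      rw [sub_add_cancel, norm_smul, hξ] at h1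
      linarith [h1]
  refine le_sValue fun F hF => ?_
  rcases le_or_gt ‖a‖ ‖a - F‖ with hle | hlt
  · refine (sValue_le_norm _ _).trans (le_trans ?_ hle)
    refine ContinuousLinearMap.opNorm_le_bound _ (norm_nonneg _) fun v => ?_
    have h1 : a' v = a (v - (inner ℂ ξ v : ℂ) • ξ) := by
      rw [ha'v, map_sub, map_smul, haξ, smul_smul, mul_comm]
    have h2 : ‖v - (inner ℂ ξ v : ℂ) • ξ‖ ≤ ‖v‖ := by
      refine abs_le_of_sq_le_sq' ?_ (norm_nonneg _) |>.2
      rw [hproj]; linarith [sq_nonneg ‖(inner ℂ ξ v : ℂ)‖]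
    rw [h1]
    exact (a.le_opNorm _).trans (by gcongr)
  · set d : ℂ := inner ℂ η (F ξ) with hd
    have hd0 : d ≠ 0 := by
      intro h0
      have h1 : inner ℂ η ((a - F) ξ) = (‖a‖ : ℂ) := by
        rw [sub_apply, inner_sub_right, h, ← hd, h0, sub_zero]
      have h2 := norm_inner_le_norm (𝕜 := ℂ) η ((a - F) ξ)
      rw [h1, hη, Complex.norm_real, norm_norm] at h2
      have h3 := (a - F).le_opNorm ξ
      rw [hξ] at h3
      linarith
    -- the Schur complement of `F` with respect to `ξ` and `η`
    set F' : H →L[ℂ] H := F - (d⁻¹ • (innerSL ℂ η ∘L F)).smulRight (F ξ) with hF'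
    have hF'v : ∀ v, F' v = F (v - (d⁻¹ * inner ℂ η (F v)) • ξ) := fun v => by
      simp [hF']
    have hηF' : ∀ v, inner ℂ η (F' v) = (0 : ℂ) := fun v => by
      rw [hF'v, map_sub, map_smul, inner_sub_right, inner_smul_right, ← hd]
      field_simp
      simp
    have hrank : LinearMap.rank (F' : H →ₗ[ℂ] H) ≤ (n : Cardinal) := by
      have hfin : FiniteDimensional ℂ (LinearMap.range (F : H →ₗ[ℂ] H)) :=
        Module.rank_lt_aleph0_iff.1 (lt_of_le_of_lt hF Cardinal.natCast_lt_aleph0)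
      have hlt' : LinearMap.range (F' : H →ₗ[ℂ] H) < LinearMap.range (F : H →ₗ[ℂ] H) := by
        refine lt_of_le_of_ne ?_ fun heq => ?_
        · rintro _ ⟨v, rfl⟩
          exact ⟨_, (hF'v v).symm⟩
        · have hmem : F ξ ∈ LinearMap.range (F' : H →ₗ[ℂ] H) := by
            rw [heq]; exact ⟨ξ, rfl⟩
          obtain ⟨v, hv⟩ := hmem
          have : F' v = F ξ := hv
          exact hd0 (by rw [hd, ← this, hηF'])
      have hfin' : FiniteDimensional ℂ (LinearMap.range (F' : H →ₗ[ℂ] H)) :=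
        Submodule.finiteDimensional_of_le hlt'.le
      have h1 := Submodule.finrank_lt_finrank_of_lt hlt'
      rw [LinearMap.rank, ← Module.finrank_eq_rank] at hF ⊢
      norm_cast at hF ⊢
      omega
    refine (sValue_le_norm_sub _ F' hrank).trans ?_
    refine ContinuousLinearMap.opNorm_le_bound _ (norm_nonneg _) fun v => ?_
    set w := v - (d⁻¹ * inner ℂ η (F v)) • ξ with hw
    have hproj_eq : w - (inner ℂ ξ w : ℂ) • ξ = v - (inner ℂ ξ v : ℂ) • ξ := by
      rw [hw, inner_sub_right, inner_smul_right, hξξ, sub_smul, mul_one]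
      abel
    have ha'w : a' v = a w - ((‖a‖ : ℂ) * inner ℂ ξ w) • η := by
      rw [ha'v, hw, map_sub, map_smul, haξ, inner_sub_right, inner_smul_right, hξξ, mul_sub,
        sub_smul, smul_smul]
      rw [mul_one, mul_comm (‖a‖ : ℂ) (d⁻¹ * inner ℂ η (F v))]
      abel
    have hsplit : (a - F) w = (a' - F') v + ((‖a‖ : ℂ) * inner ℂ ξ w) • η := by
      simp only [sub_apply]
      rw [ha'w, hF'v v]
      abel
    have horth : inner ℂ ((a' - F') v) (((‖a‖ : ℂ) * inner ℂ ξ w) • η) = (0 : ℂ) := by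
      have h0 : inner ℂ η ((a' - F') v) = (0 : ℂ) := by
        rw [sub_apply, inner_sub_right, hηF', ha'w, inner_sub_right, hηa,
          inner_smul_right, hηη]
        ring
      rw [inner_smul_right, inner_eq_zero_symm.1 h0, mul_zero]
    have hpyth := norm_add_sq_eq_norm_sq_add_norm_sq_of_inner_eq_zero _ _ horth
    rw [← hsplit, norm_smul, hη, norm_mul, Complex.norm_real, norm_norm, mul_one] at hpyth
    have h1 : ‖(a - F) w‖ ≤ ‖a - F‖ * ‖w‖ := (a - F).le_opNorm w
    have h2 : ‖w‖ ^ 2 - ‖(inner ℂ ξ w : ℂ)‖ ^ 2 ≤ ‖v‖ ^ 2 := by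
      rw [← hproj w, hproj_eq, hproj v]
      linarith [sq_nonneg ‖(inner ℂ ξ v : ℂ)‖]
    have h3 : ‖(a - F) w‖ ^ 2 ≤ ‖a - F‖ ^ 2 * ‖w‖ ^ 2 := by
      rw [← mul_pow]; gcongr
    have h4 : ‖a - F‖ ^ 2 ≤ ‖a‖ ^ 2 := by gcongr
    refine abs_le_of_sq_le_sq' ?_ (by positivity) |>.2
    rw [mul_pow]
    nlinarith [mul_le_mul_of_nonneg_right h4 (sq_nonneg ‖(inner ℂ ξ w : ℂ)‖),
      mul_le_mul_of_nonneg_left h2 (sq_nonneg ‖a - F‖)]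

/-- A nonzero compact operator attains its norm. -/
theorem exists_inner_apply_eq_norm [CompleteSpace H] {a : H →L[ℂ] H}
    (hc : IsCompactOperator a) (ha : a ≠ 0) :
    ∃ ξ η : H, ‖ξ‖ = 1 ∧ ‖η‖ = 1 ∧ inner ℂ η (a ξ) = (‖a‖ : ℂ) := by
  have hpos : 0 < ‖a‖ := norm_pos_iff.2 ha
  obtain ⟨ξ, hξ, haξ⟩ : ∃ ξ : H, ‖ξ‖ ≤ 1 ∧ ‖a ξ‖ = ‖a‖ := by
    have hex : ∀ n : ℕ, ∃ x : H, ‖x‖ < 1 ∧ ‖a‖ - 1 / ((n : ℝ) + 1) < ‖a x‖ := fun n =>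
      a.exists_lt_apply_of_lt_opNorm (sub_lt_self _ (by positivity))
    choose x hx1 hx2 using hex
    have hlim : Filter.Tendsto (fun n => ‖a (x n)‖) Filter.atTop (nhds ‖a‖) := by
      refine tendsto_of_tendsto_of_tendsto_of_le_of_le (g := fun n : ℕ => ‖a‖ - 1 / ((n : ℝ) + 1))
        (h := fun _ => ‖a‖) ?_ tendsto_const_nhds (fun n => (hx2 n).le) fun n => ?_
      · simpa using tendsto_const_nhds.sub (tendsto_one_div_add_atTop_nhds_zero_nat (𝕜 := ℝ))
      · exact (a.le_opNorm _).trans (mul_le_of_le_one_right (norm_nonneg _) (hx1 n).le)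
    obtain ⟨K, hK, hKs⟩ := IsCompactOperator.image_closedBall_subset_compact
      (f := (a : H →ₗ[ℂ] H)) hc 1
    obtain ⟨z, -, φ, hφ, hz⟩ := hK.tendsto_subseq (x := fun n => a (x n)) fun n =>
      hKs ⟨x n, by simpa using (hx1 n).le, rfl⟩
    have hlim' := hlim.comp hφ.tendsto_atTop
    let T := ContinuousLinearMap.adjoint a
    have hT : ‖T‖ = ‖a‖ := LinearIsometryEquiv.norm_map _ a
    have hbound : ∀ v : H, ‖v‖ ≤ 1 →
        ‖T (a v) - ((‖a‖ ^ 2 : ℝ) : ℂ) • v‖ ^ 2 ≤ ‖a‖ ^ 2 * (‖a‖ ^ 2 - ‖a v‖ ^ 2) := by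
      intro v hv
      have h1 : ‖T (a v)‖ ^ 2 ≤ ‖a‖ ^ 2 * ‖a v‖ ^ 2 := by
        rw [← mul_pow, ← hT]; gcongr; exact T.le_opNorm _
      have h2 : ‖v‖ ^ 2 ≤ 1 := pow_le_one₀ (norm_nonneg _) hv
      rw [norm_sub_sq (𝕜 := ℂ), inner_smul_right, ContinuousLinearMap.adjoint_inner_left,
        inner_self_eq_norm_sq_to_K, norm_smul, Complex.norm_real, Real.norm_eq_abs,
        abs_of_nonneg (sq_nonneg _)]
      have h3 : RCLike.re (((‖a‖ ^ 2 : ℝ) : ℂ) * (‖a v‖ : ℂ) ^ 2) = ‖a‖ ^ 2 * ‖a v‖ ^ 2 := by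
        rw [← Complex.ofReal_pow, ← Complex.ofReal_mul]
        simp only [RCLike.re_to_complex, Complex.ofReal_re]
      have h4 : (‖a‖ ^ 2) ^ 2 * ‖v‖ ^ 2 ≤ (‖a‖ ^ 2) ^ 2 :=
        mul_le_of_le_one_right (by positivity) h2
      erw [h3]
      nlinarith
    have hdiff : Filter.Tendsto (fun n => T (a (x (φ n))) - ((‖a‖ ^ 2 : ℝ) : ℂ) • x (φ n))
        Filter.atTop (nhds 0) := by
      rw [tendsto_zero_iff_norm_tendsto_zero]
      have hsq : Filter.Tendsto
          (fun n => ‖T (a (x (φ n))) - ((‖a‖ ^ 2 : ℝ) : ℂ) • x (φ n)‖ ^ 2)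
          Filter.atTop (nhds 0) := by
        refine squeeze_zero (fun _ => sq_nonneg _) (fun n => hbound _ (hx1 (φ n)).le) ?_
        have := ((hlim'.pow 2).const_sub (‖a‖ ^ 2)).const_mul (‖a‖ ^ 2)
        rwa [sub_self, mul_zero] at this
      simpa [Real.sqrt_sq] using hsq.sqrt
    have hsm : Filter.Tendsto (fun n => ((‖a‖ ^ 2 : ℝ) : ℂ) • x (φ n)) Filter.atTop
        (nhds (T z)) := by
      simpa using ((T.continuous.tendsto z).comp hz).sub hdiff
    have hne : ((‖a‖ ^ 2 : ℝ) : ℂ) ≠ 0 := by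
      exact_mod_cast (pow_pos hpos 2).ne'
    have hconv : Filter.Tendsto (fun n => x (φ n)) Filter.atTop
        (nhds (((‖a‖ ^ 2 : ℝ) : ℂ)⁻¹ • T z)) := by
      exact (hsm.const_smul (((‖a‖ ^ 2 : ℝ) : ℂ)⁻¹)).congr fun n => inv_smul_smul₀ hne _
    refine ⟨_, le_of_tendsto hconv.norm (Filter.Eventually.of_forall fun n => (hx1 (φ n)).le), ?_⟩
    exact tendsto_nhds_unique ((a.continuous.tendsto _).comp hconv).norm hlim'
  have hξ1 : ‖ξ‖ = 1 := by
    refine le_antisymm hξ ?_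
    have := a.le_opNorm ξ
    rw [haξ] at this
    exact (le_mul_iff_one_le_right hpos).1 this
  refine ⟨ξ, (‖a‖ : ℂ)⁻¹ • a ξ, hξ1, ?_, ?_⟩
  · rw [norm_smul, haξ, norm_inv, Complex.norm_real, norm_norm, inv_mul_cancel₀ hpos.ne']
  · have hne : (‖a‖ : ℂ) ≠ 0 := by exact_mod_cast hpos.ne'
    rw [inner_smul_left, inner_self_eq_norm_sq_to_K, haξ, map_inv₀, Complex.conj_ofReal]
    simp only [Complex.coe_algebraMap]
    field_simp

/-- An element of the trace ball at which the functional `x ↦ Re ⟪η, x ξ⟫` is at least `1`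
is the rank one operator `η ⊗ ξ`. -/
theorem eq_rankOneOp_of_one_le_re_inner [CompleteSpace H] {x : H →L[ℂ] H}
    (hx : x ∈ traceBall H) {ξ η : H} (hξ : ‖ξ‖ = 1) (hη : ‖η‖ = 1)
    (h : 1 ≤ (inner ℂ η (x ξ)).re) : x = rankOneOp η ξ := by
  have h1 : ‖inner ℂ η (x ξ)‖ ≤ ‖x‖ := by
    have h2 := norm_inner_le_norm (𝕜 := ℂ) η (x ξ)
    have h3 := x.le_opNorm ξ
    rw [hη, one_mul] at h2
    rw [hξ, mul_one] at h3
    exact h2.trans h3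
  have hsum := norm_add_tsum_sValue_succ hx.1
  have htail : 0 ≤ ∑' n, sValue x (n + 1) := tsum_nonneg fun n => sValue_nonneg x _
  have hre := Complex.re_le_norm (inner ℂ η (x ξ))
  have hle := hx.2
  have hnorm : ‖x‖ = 1 := by linarith
  have hinner : inner ℂ η (x ξ) = (‖x‖ : ℂ) := by
    have hre1 : (inner ℂ η (x ξ)).re = ‖inner ℂ η (x ξ)‖ := by linarith
    rw [Complex.re_eq_norm] at hre1
    have h4 : (inner ℂ η (x ξ)).re = 1 := by linarith
    apply Complex.ext
    · simp [hnorm, h4]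
    · simpa using (Complex.nonneg_iff.1 hre1).2.symm
  have hs1 : sValue x 1 ≤ 0 := by
    have h5 := ((summable_nat_add_iff 1).2 hx.1.2).le_tsum 0 fun n _ => sValue_nonneg x (n + 1)
    simp only [zero_add] at h5
    linarith
  have h6 := (sValue_sub_rankOneOp_le hξ hη hinner 0).trans hs1
  rw [sValue_zero, hnorm, one_smul] at h6
  exact sub_eq_zero.1 (norm_le_zero_iff.1 h6)

theorem rankOneOp_mem_extremePoints [CompleteSpace H] {ξ η : H} (hξ : ‖ξ‖ = 1)
    (hη : ‖η‖ = 1) : rankOneOp η ξ ∈ Set.extremePoints ℝ (traceBall H) := by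
  refine ⟨rankOneOp_mem_traceBall hη hξ, ?_⟩
  rintro x hx y hy ⟨s, t, hs, ht, hst, hxy⟩
  have hle : ∀ z ∈ traceBall H, (inner ℂ η (z ξ)).re ≤ 1 := fun z hz => by
    have h2 := norm_inner_le_norm (𝕜 := ℂ) η (z ξ)
    have h3 := z.le_opNorm ξ
    rw [hη, one_mul] at h2
    rw [hξ, mul_one] at h3
    linarith [Complex.re_le_norm (inner ℂ η (z ξ)), norm_le_traceNorm hz.1, hz.2]
  have hval : s * (inner ℂ η (x ξ)).re + t * (inner ℂ η (y ξ)).re = 1 := by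
    have h1 : (inner ℂ η ((s • x + t • y) ξ)).re = 1 := by
      rw [hxy, rankOneOp_apply, inner_smul_right, inner_self_eq_norm_sq_to_K,
        inner_self_eq_norm_sq_to_K, hξ, hη]
      simp
    rw [← h1]
    simp [inner_smul_right_eq_smul]
  refine eq_rankOneOp_of_one_le_re_inner hx hξ hη ?_
  nlinarith [hle x hx, hle y hy]

theorem le_lambdaFn {a e y : H →L[ℂ] H} {t : ℝ} (ht : t ∈ Set.Icc (0 : ℝ) 1)
    (he : e ∈ Set.extremePoints ℝ (traceBall H)) (hy : y ∈ traceBall H)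
    (h : a = t • e + (1 - t) • y) : t ≤ lambdaFn a :=
  le_csSup ⟨1, fun _ hs => hs.1.2⟩ ⟨ht, e, he, y, hy, h⟩

theorem one_le_lambdaFn_of_mem_extremePoints {a : H →L[ℂ] H}
    (ha : a ∈ Set.extremePoints ℝ (traceBall H)) : 1 ≤ lambdaFn a :=
  le_lambdaFn (by simp) ha ha.1 (by simp)

theorem lambdaFn_zero_pos [CompleteSpace H] (h0 : (0 : H →L[ℂ] H) ∈ traceBall H) :
    0 < lambdaFn (0 : H →L[ℂ] H) := by
  rcases subsingleton_or_nontrivial H with hH | hH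
  · refine zero_lt_one.trans_le (one_le_lambdaFn_of_mem_extremePoints ⟨h0, ?_⟩)
    exact fun _ _ _ _ _ => Subsingleton.elim _ _
  · obtain ⟨ξ, hξ⟩ := exists_norm_eq H zero_le_one
    have hneg : ‖-ξ‖ = 1 := by rw [norm_neg, hξ]
    refine lt_of_lt_of_le (by norm_num : (0 : ℝ) < 1 / 2) (le_lambdaFn (by norm_num)
      (rankOneOp_mem_extremePoints hξ hξ) (rankOneOp_mem_traceBall hneg hξ) ?_)
    ext v
    norm_num

theorem norm_le_lambdaFn [CompleteSpace H] {a : H →L[ℂ] H} (ha : a ∈ traceBall H)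
    (h0 : a ≠ 0) : ‖a‖ ≤ lambdaFn a := by
  obtain ⟨ξ, η, hξ, hη, h⟩ := exists_inner_apply_eq_norm ha.1.1 h0
  have hle : ‖a‖ ≤ 1 := (norm_le_traceNorm ha.1).trans ha.2
  rcases hle.eq_or_lt with h1 | h1
  · have : a = rankOneOp η ξ :=
      eq_rankOneOp_of_one_le_re_inner ha hξ hη (by simp [h, h1])
    rw [h1]
    exact one_le_lambdaFn_of_mem_extremePoints (this ▸ rankOneOp_mem_extremePoints hξ hη)
  · have hpos : 0 < 1 - ‖a‖ := sub_pos.2 h1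
    set a' := a - ‖a‖ • rankOneOp η ξ with ha'
    have hs : ∀ n, sValue ((1 - ‖a‖)⁻¹ • a') n ≤ (1 - ‖a‖)⁻¹ * sValue a (n + 1) := fun n => by
      refine (sValue_smul_le _ _ _).trans ?_
      rw [abs_of_pos (inv_pos.2 hpos)]
      gcongr
      exact sValue_sub_rankOneOp_le hξ hη h n
    have hsum : Summable fun n => (1 - ‖a‖)⁻¹ * sValue a (n + 1) :=
      ((summable_nat_add_iff 1).2 ha.1.2).mul_left _
    have hsum' := Summable.of_nonneg_of_le (fun n => sValue_nonneg _ n) hs hsum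
    have hcomp : IsCompactOperator ((1 - ‖a‖)⁻¹ • a') :=
      (ha.1.1.sub ((isCompactOperator_rankOneOp η ξ).smul ‖a‖)).smul (1 - ‖a‖)⁻¹
    refine le_lambdaFn ⟨norm_nonneg _, hle⟩ (rankOneOp_mem_extremePoints hξ hη)
      (y := (1 - ‖a‖)⁻¹ • a') ⟨⟨hcomp, hsum'⟩, ?_⟩ ?_
    · refine (hsum'.tsum_le_tsum hs hsum).trans ?_
      rw [tsum_mul_left, inv_mul_le_iff₀ hpos]
      linarith [norm_add_tsum_sValue_succ ha.1, ha.2]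
    · rw [smul_inv_smul₀ hpos.ne', ha']
      abel

end ApproximationNumbers

/-- Let `H` be a complex Hilbert space. Then `C₁(H)` satisfies the
λ-property: `λ(a) > 0` for every `a` in the closed unit ball of `C₁(H)` with respect to the
trace norm. -/
theorem traceClass_lambdaProperty {H : Type*} [NormedAddCommGroup H] [InnerProductSpace ℂ H]
    [CompleteSpace H] (a : H →L[ℂ] H) (ha : a ∈ traceBall H) :
    0 < lambdaFn a := by
  rcases eq_or_ne a 0 with rfl | h0
  · exact lambdaFn_zero_pos ha
  · exact (norm_pos_iff.2 h0).trans_le (norm_le_lambdaFn ha h0)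
end

section
/- Let H be a finite-dimensional complex Hilbert space (identified with ℂⁿ, so that B(H) is identified with the n×n complex matrices), let a ∈ C_1(H), and let t > 0. Then the minimum value over all minimal partial isometries e ∈ B(H) of the function f_{a,t}(e) := ‖a − t·e‖₁ equals |t − μ₁(a)| + (‖a‖₁ − μ₁(a)), where μ₁(a) ≥ μ₂(a) ≥ … ≥ μₙ(a) are the singular values of a; moreover this minimum is attained. -/
section SingularValueDecomposition

open Module InnerProductSpace

variable {E : Type*} [NormedAddCommGroup E] [InnerProductSpace ℂ E] [FiniteDimensional ℂ E] {n : ℕ}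

/-- The singular value decomposition of an endomorphism of a finite-dimensional space. -/
lemma LinearMap.exists_orthonormalBasis_apply_eq_singularValues_smul (hn : finrank ℂ E = n)
    (T : E →ₗ[ℂ] E) :
    ∃ u v : OrthonormalBasis (Fin n) ℂ E, ∀ i, T (v i) = (T.singularValues i : ℂ) • u i := by
  set hT := T.isSymmetric_adjoint_comp_self
  set v := hT.eigenvectorBasis hn with hv
  have hinner (i j : Fin n) : ⟪T (v i), T (v j)⟫_ℂ =
      if i = j then (T.singularValues i : ℂ) ^ 2 else 0 := by
    rw [← LinearMap.adjoint_inner_right, ← LinearMap.comp_apply, hv,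
      hT.apply_eigenvectorBasis hn j, inner_smul_right,
      orthonormal_iff_ite.mp (hT.eigenvectorBasis hn).orthonormal i j,
      ← T.sq_singularValues_fin hn j]
    split_ifs with h <;> simp [h]
  let s : Set (Fin n) := {i | T.singularValues i ≠ 0}
  have hon : Orthonormal ℂ
      (s.domRestrict fun i => ((T.singularValues i : ℂ)⁻¹) • T (v i)) := by
    rw [orthonormal_iff_ite]
    rintro ⟨i, hi⟩ ⟨j, hj⟩
    have hi' : (T.singularValues i : ℂ) ≠ 0 := by exact_mod_cast hi
    simp only [Set.domRestrict_apply, inner_smul_left, inner_smul_right, hinner, Subtype.mk.injEq]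
    split_ifs with h
    · subst h
      simp only [map_inv₀, Complex.conj_ofReal]
      field_simp
    · simp
  obtain ⟨u, hu⟩ := hon.exists_orthonormalBasis_extension_of_card_eq (by simpa using hn)
  refine ⟨u, v, fun i => ?_⟩
  by_cases hi : T.singularValues i = 0
  · have h := hinner i i
    simp only [hi] at h
    simpa [hi] using h
  · have hi' : (T.singularValues i : ℂ) ≠ 0 := by exact_mod_cast hi
    rw [hu i hi, smul_inv_smul₀ hi']

lemma sValue_le_singularValues (a : E →L[ℂ] E) (k : ℕ) :
    sValue a k ≤ (a : E →ₗ[ℂ] E).singularValues k := by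
  classical
  set s := (a : E →ₗ[ℂ] E).singularValues with hs
  obtain ⟨u, v, huv⟩ :=
    LinearMap.exists_orthonormalBasis_apply_eq_singularValues_smul rfl (a : E →ₗ[ℂ] E)
  rw [← hs] at huv
  have hexp (x : E) : a x = ∑ i, ⟪v i, x⟫_ℂ • (s i : ℂ) • u i := by
    conv_lhs => rw [← v.sum_repr' x]
    simp only [map_sum, map_smul]
    exact Finset.sum_congr rfl fun i _ => congrArg _ (huv i)
  let J : Finset (Fin (finrank ℂ E)) := {i | (i : ℕ) < k}
  let F : E →L[ℂ] E := ∑ i ∈ J, (innerSL ℂ (v i)).smulRight ((s i : ℂ) • u i)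
  have hF (x : E) : F x = ∑ i ∈ J, ⟪v i, x⟫_ℂ • (s i : ℂ) • u i := by simp [F]
  have hrank : LinearMap.rank (F : E →ₗ[ℂ] E) ≤ (k : Cardinal) := by
    have hle : LinearMap.range (F : E →ₗ[ℂ] E) ≤ Submodule.span ℂ (J.image u : Set E) := by
      rintro _ ⟨x, rfl⟩
      rw [ContinuousLinearMap.coe_coe, hF]
      refine Submodule.sum_mem _ fun i hi => Submodule.smul_mem _ _ (Submodule.smul_mem _ _ ?_)
      exact Submodule.subset_span (by simpa using ⟨i, hi, rfl⟩)
    refine (Submodule.rank_mono hle).trans ((rank_span_finset_le _).trans ?_)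
    refine Nat.cast_le.mpr (Finset.card_image_le.trans ?_)
    calc J.card = (J.image Fin.val).card := (Finset.card_image_of_injective _ Fin.val_injective).symm
      _ ≤ (Finset.range k).card := Finset.card_le_card fun i hi => by
          obtain ⟨j, hj, rfl⟩ := Finset.mem_image.mp hi
          simpa [J] using hj
      _ = k := Finset.card_range k
  have hsk : 0 ≤ s k := (a : E →ₗ[ℂ] E).singularValues_nonneg k
  refine le_trans (b := ‖a - F‖) (csInf_le ⟨0, ?_⟩ ⟨F, hrank, rfl⟩) ?_
  · rintro _ ⟨G, _, rfl⟩
    exact norm_nonneg _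
  refine ContinuousLinearMap.opNorm_le_bound _ hsk fun x => ?_
  have hcoef (i) : ⟪u i, (a - F) x⟫_ℂ = if (i : ℕ) < k then 0 else ⟪v i, x⟫_ℂ * s i := by
    rw [sub_apply, hexp, hF, inner_sub_right, inner_sum, inner_sum]
    simp only [inner_smul_right, orthonormal_iff_ite.mp u.orthonormal, mul_ite, mul_one, mul_zero,
      Finset.sum_ite_eq, Finset.mem_univ, if_true]
    simp only [J, Finset.mem_filter, Finset.mem_univ, true_and]
    split_ifs <;> simp
  refine le_of_sq_le_sq ?_ (by positivity)
  rw [mul_pow, ← u.sum_sq_norm_inner_right, ← v.sum_sq_norm_inner_right x, Finset.mul_sum]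
  refine Finset.sum_le_sum fun i _ => ?_
  rw [hcoef]
  split_ifs with h
  · simpa using by positivity
  · have h1 : s i ≤ s k := (a : E →ₗ[ℂ] E).singularValues_antitone (not_lt.mp h)
    have h0 : 0 ≤ s i := (a : E →ₗ[ℂ] E).singularValues_nonneg i
    rw [norm_mul, mul_pow, mul_comm, Complex.norm_real, Real.norm_eq_abs, sq_abs]
    gcongr

lemma singularValues_le_sValue (a : E →L[ℂ] E) (k : ℕ) :
    (a : E →ₗ[ℂ] E).singularValues k ≤ sValue a k := by
  set s := (a : E →ₗ[ℂ] E).singularValues with hs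
  have hsk : 0 ≤ s k := (a : E →ₗ[ℂ] E).singularValues_nonneg k
  refine le_csInf ⟨_, 0, by simp, rfl⟩ ?_
  rintro _ ⟨F, hF, rfl⟩
  by_cases hk : finrank ℂ E ≤ k
  · rw [hs, LinearMap.singularValues_of_finrank_le _ hk]
    exact norm_nonneg _
  push Not at hk
  obtain ⟨u, v, huv⟩ :=
    LinearMap.exists_orthonormalBasis_apply_eq_singularValues_smul rfl (a : E →ₗ[ℂ] E)
  rw [← hs] at huv
  let g : Fin (k + 1) → Fin (finrank ℂ E) := Fin.castLE hk
  have hg : Function.Injective g := Fin.castLE_injective hk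
  let L : (Fin (k + 1) → ℂ) →ₗ[ℂ] E := Fintype.linearCombination ℂ (v ∘ g)
  have hL (c) : L c = ∑ i, c i • v (g i) := rfl
  have hnot : ¬ Function.Injective ((F : E →ₗ[ℂ] E) ∘ₗ L) := fun hinj => by
    have h1 := LinearMap.finrank_range_of_inj hinj
    have h2 := Submodule.finrank_mono (LinearMap.range_comp_le_range L (F : E →ₗ[ℂ] E))
    have h3 : finrank ℂ (LinearMap.range (F : E →ₗ[ℂ] E)) ≤ k := finrank_le_of_rank_le hF
    rw [finrank_fin_fun] at h1
    omega
  rw [← LinearMap.ker_eq_bot, ← ne_eq, Submodule.ne_bot_iff] at hnot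
  obtain ⟨c, hc, hc0⟩ := hnot
  have hFc : F (L c) = 0 := hc
  have ha : a (L c) = ∑ i, (c i * s (g i)) • u (g i) := by
    rw [hL, map_sum]
    refine Finset.sum_congr rfl fun i _ => ?_
    rw [map_smul, mul_smul]
    exact congrArg _ (huv _)
  have hnorm (w : OrthonormalBasis (Fin (finrank ℂ E)) ℂ E) (d : Fin (k + 1) → ℂ) :
      ‖∑ i, d i • w (g i)‖ ^ 2 = ∑ i, ‖d i‖ ^ 2 := by
    have h := (w.orthonormal.comp g hg).inner_sum d d Finset.univ
    simp only [Function.comp_apply, inner_self_eq_norm_sq_to_K, RCLike.conj_mul] at h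
    exact_mod_cast h
  have hpos : 0 < ‖L c‖ := by
    have h : 0 < ‖L c‖ ^ 2 := by
      rw [hL, hnorm]
      obtain ⟨i, hi⟩ := Function.ne_iff.mp hc0
      exact Finset.sum_pos' (fun _ _ => by positivity)
        ⟨i, Finset.mem_univ i, pow_pos (norm_pos_iff.mpr hi) 2⟩
    exact lt_of_le_of_ne (norm_nonneg _) fun h0 => by simp [← h0] at h
  refine le_of_mul_le_mul_right (le_trans (le_of_sq_le_sq ?_ (norm_nonneg _))
    ((a - F).le_opNorm (L c))) hpos
  rw [sub_apply, hFc, sub_zero, ha, hnorm, mul_pow, hL, hnorm, Finset.mul_sum]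
  refine Finset.sum_le_sum fun i _ => ?_
  have h1 : s k ≤ s (g i) := (a : E →ₗ[ℂ] E).singularValues_antitone (Nat.lt_succ_iff.mp i.2)
  rw [norm_mul, mul_pow, mul_comm, Complex.norm_real, Real.norm_eq_abs, sq_abs]
  gcongr

lemma sValue_eq_singularValues (a : E →L[ℂ] E) (k : ℕ) :
    sValue a k = (a : E →ₗ[ℂ] E).singularValues k :=
  (sValue_le_singularValues a k).antisymm (singularValues_le_sValue a k)

lemma traceNorm_eq_sum_singularValues (hn : finrank ℂ E = n) (a : E →L[ℂ] E) :
    traceNorm a = ∑ i : Fin n, (a : E →ₗ[ℂ] E).singularValues i := by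
  simp only [traceNorm, sValue_eq_singularValues]
  rw [tsum_eq_sum (s := Finset.range n), Finset.sum_range]
  intro k hk
  exact LinearMap.singularValues_of_finrank_le _ (by simpa [hn] using hk)

/-- A contraction `W` satisfies `Re tr (W b) ≤ ‖b‖₁`. -/
lemma re_trace_comp_le_traceNorm (W b : E →L[ℂ] E) (hW : ∀ x, ‖W x‖ ≤ ‖x‖) :
    (LinearMap.trace ℂ E (W ∘L b : E →L[ℂ] E)).re ≤ traceNorm b := by
  obtain ⟨u, v, huv⟩ :=
    LinearMap.exists_orthonormalBasis_apply_eq_singularValues_smul rfl (b : E →ₗ[ℂ] E)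
  rw [LinearMap.trace_eq_sum_inner _ v, traceNorm_eq_sum_singularValues rfl, Complex.re_sum]
  refine Finset.sum_le_sum fun i _ => ?_
  have hs : 0 ≤ (b : E →ₗ[ℂ] E).singularValues i := LinearMap.singularValues_nonneg _ _
  have hbi : b (v i) = _ := huv i
  have h1 : ‖⟪v i, W (u i)⟫_ℂ‖ ≤ 1 := by
    simpa using (norm_inner_le_norm (v i) (W (u i))).trans
      (mul_le_mul_of_nonneg_left (hW (u i)) (norm_nonneg _))
  simp only [ContinuousLinearMap.coe_coe, ContinuousLinearMap.comp_apply, hbi, map_smul,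
    inner_smul_right, Complex.re_ofReal_mul]
  exact mul_le_of_le_one_right hs ((Complex.re_le_norm _).trans h1)

/-- The trace norm is attained at a unitary. -/
lemma exists_traceNorm_eq_re_trace_comp (b : E →L[ℂ] E) :
    ∃ W : E ≃ₗᵢ[ℂ] E, traceNorm b =
      (LinearMap.trace ℂ E ((W : E →L[ℂ] E) ∘L b : E →L[ℂ] E)).re := by
  obtain ⟨u, v, huv⟩ :=
    LinearMap.exists_orthonormalBasis_apply_eq_singularValues_smul rfl (b : E →ₗ[ℂ] E)
  refine ⟨u.equiv v (Equiv.refl _), ?_⟩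
  rw [LinearMap.trace_eq_sum_inner _ v, traceNorm_eq_sum_singularValues rfl, Complex.re_sum]
  refine Finset.sum_congr rfl fun i _ => ?_
  have hbi : b (v i) = _ := huv i
  simp [hbi, -Complex.coe_smul, inner_smul_right]

end SingularValueDecomposition

section RankOne

open Module InnerProductSpace

variable {E : Type*} [NormedAddCommGroup E] [InnerProductSpace ℂ E]

lemma rankOneOp_apply_s6 (η ξ x : E) : rankOneOp η ξ x = ⟪ξ, x⟫_ℂ • η := by
  simp [rankOneOp]

lemma adjoint_rankOneOp_apply [CompleteSpace E] (η ξ x : E) :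
    ContinuousLinearMap.adjoint (rankOneOp η ξ) x = ⟪η, x⟫_ℂ • ξ := by
  refine ext_inner_left ℂ fun y => ?_
  rw [ContinuousLinearMap.adjoint_inner_right, rankOneOp_apply_s6, inner_smul_left, inner_smul_right,
    inner_conj_symm, mul_comm]

lemma isMinimalPartialIsometry_rankOneOp [CompleteSpace E] {η ξ : E} (hη : ‖η‖ = 1)
    (hξ : ‖ξ‖ = 1) : IsMinimalPartialIsometry (rankOneOp η ξ) := by
  have hη0 : η ≠ 0 := fun h => by simp [h] at hη
  constructor
  · ext x
    simp [rankOneOp_apply_s6, adjoint_rankOneOp_apply, hη, hξ]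
  · have hr : LinearMap.range (rankOneOp η ξ : E →ₗ[ℂ] E) = ℂ ∙ η := by
      refine le_antisymm ?_ ?_
      · rintro _ ⟨x, rfl⟩
        exact Submodule.mem_span_singleton.mpr ⟨⟪ξ, x⟫_ℂ, (rankOneOp_apply_s6 η ξ x).symm⟩
      · rw [Submodule.span_singleton_le_iff_mem]
        exact ⟨ξ, by simp [rankOneOp_apply_s6, hξ]⟩
    rw [LinearMap.rank, hr, rank_submodule_eq_one_iff]
    exact ⟨η, Submodule.mem_span_singleton_self η, hη0, le_rfl⟩

lemma IsMinimalPartialIsometry.exists_eq_rankOneOp [CompleteSpace E] {e : E →L[ℂ] E}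
    (he : IsMinimalPartialIsometry e) :
    ∃ η ξ : E, ‖η‖ = 1 ∧ ‖ξ‖ = 1 ∧ e = rankOneOp η ξ := by
  obtain ⟨hpi, hrank⟩ := he
  rw [LinearMap.rank, rank_submodule_eq_one_iff] at hrank
  obtain ⟨y, hyrange, hy0, hy⟩ := hrank
  have hyn : ‖y‖ ≠ 0 := norm_ne_zero_iff.mpr hy0
  set η : E := ((‖y‖⁻¹ : ℝ) : ℂ) • y with hηdef
  have hη : ‖η‖ = 1 := by
    rw [hηdef, norm_smul, Complex.norm_real, norm_inv, norm_norm, inv_mul_cancel₀ hyn]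
  have hηη : ⟪η, η⟫_ℂ = 1 := by simp [inner_self_eq_norm_sq_to_K, hη]
  set ξ : E := ContinuousLinearMap.adjoint e η with hξdef
  have hex (x : E) : e x = ⟪ξ, x⟫_ℂ • η := by
    obtain ⟨c, hc⟩ := Submodule.mem_span_singleton.mp (hy ⟨x, rfl⟩)
    have hc' : e x = (c * ‖y‖) • η := by
      rw [hηdef, smul_smul, mul_assoc, ← Complex.ofReal_mul, mul_inv_cancel₀ hyn]
      simpa using hc.symm
    rw [hξdef, ContinuousLinearMap.adjoint_inner_left, hc', inner_smul_right, hηη, mul_one]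
  have heq : e = rankOneOp η ξ := by
    ext x
    rw [hex, rankOneOp_apply_s6]
  refine ⟨η, ξ, hη, ?_, heq⟩
  have hη0 : η ≠ 0 := fun h => by simp [h] at hη
  obtain ⟨x, hx⟩ := hyrange
  have hd : ⟪ξ, x⟫_ℂ ≠ 0 := fun h => hy0 (by
    rw [← hx, ContinuousLinearMap.coe_coe, hex, h, zero_smul])
  have h := DFunLike.congr_fun hpi x
  simp only [ContinuousLinearMap.comp_apply] at h
  rw [hex x, map_smul, map_smul, ← hξdef, hex, inner_self_eq_norm_sq_to_K, smul_smul] at h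
  have h1 := mul_left_cancel₀ hd ((smul_left_injective ℂ hη0 h).trans (mul_one _).symm)
  have h2 : ‖ξ‖ ^ 2 = 1 := Complex.ofReal_injective (by simpa using h1)
  exact (pow_eq_one_iff_of_nonneg (norm_nonneg ξ) two_ne_zero).mp h2

/-- For vectors of equal norm there is a contraction (in fact a unitary) of the form
`z ↦ z - c ⟪w, z⟫ w` mapping `y` to `-x`, with `0 ≤ Re c` and `Re c * ‖w‖² ≤ 2`. -/
lemma exists_complex_reflection {x y : E} (hxy : ‖x‖ = ‖y‖) :
    ∃ (w : E) (c : ℂ), 0 ≤ c.re ∧ c.re * ‖w‖ ^ 2 ≤ 2 ∧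
      (∀ z, ‖z - (c * ⟪w, z⟫_ℂ) • w‖ ≤ ‖z‖) ∧ y - (c * ⟪w, y⟫_ℂ) • w = -x := by
  by_cases h0 : x + y = 0
  · exact ⟨0, 0, by simp, by simp, by simp, by simpa using (neg_eq_of_add_eq_zero_right h0).symm⟩
  set w := x + y with hw
  set d := ⟪w, y⟫_ℂ with hd
  have hwpos : 0 < ‖w‖ ^ 2 := by positivity
  have hdre : 2 * d.re = ‖w‖ ^ 2 := by
    have h1 : ‖w‖ ^ 2 = ‖x‖ ^ 2 + 2 * (⟪x, y⟫_ℂ).re + ‖y‖ ^ 2 := norm_add_sq (𝕜 := ℂ) x y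
    have h2 : d.re = (⟪x, y⟫_ℂ).re + ‖y‖ ^ 2 := by
      rw [hd, hw, inner_add_left, Complex.add_re, inner_self_eq_norm_sq_to_K]
      norm_cast
    rw [h1, h2, hxy]
    ring
  have hd0 : d ≠ 0 := fun h => by simp [h] at hdre; simp [← hdre] at hwpos
  have hns : 0 < Complex.normSq d := Complex.normSq_pos.mpr hd0
  have hre : (d⁻¹).re = d.re / Complex.normSq d := Complex.inv_re d
  have hcw : 2 * (d⁻¹).re = ‖d⁻¹‖ ^ 2 * ‖w‖ ^ 2 := by
    rw [hre, ← hdre, norm_inv, inv_pow, ← Complex.normSq_eq_norm_sq]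
    field_simp
  refine ⟨w, d⁻¹, ?_, ?_, fun z => ?_, ?_⟩
  · rw [hre]
    exact div_nonneg (by linarith) hns.le
  · rw [hre, ← hdre, div_mul_eq_mul_div, div_le_iff₀ hns, Complex.normSq_apply]
    nlinarith [mul_self_nonneg d.im]
  · refine le_of_sq_le_sq (le_of_eq ?_) (norm_nonneg _)
    rw [norm_sub_sq (𝕜 := ℂ), inner_smul_right, norm_smul, norm_mul, mul_pow, mul_pow,
      mul_assoc, ← inner_conj_symm z w, Complex.mul_conj, Complex.normSq_eq_norm_sq]
    simp only [RCLike.re_to_complex, Complex.re_mul_ofReal]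
    linear_combination (-‖⟪w, z⟫_ℂ‖ ^ 2) * hcw
  · rw [← hd, inv_mul_cancel₀ hd0, one_smul, hw]
    abel

variable [FiniteDimensional ℂ E]

lemma trace_comp_rankOneOp (W : E →L[ℂ] E) (η ξ : E) :
    LinearMap.trace ℂ E (W ∘L rankOneOp η ξ : E →L[ℂ] E) = ⟪ξ, W η⟫_ℂ := by
  rw [LinearMap.trace_eq_sum_inner _ (stdOrthonormalBasis ℂ E),
    ← (stdOrthonormalBasis ℂ E).sum_inner_mul_inner ξ (W η)]
  simp [rankOneOp_apply_s6, inner_smul_right]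

lemma trace_comp_sub_smul_rankOneOp (W a : E →L[ℂ] E) (t : ℝ) (η ξ : E) :
    LinearMap.trace ℂ E (W ∘L (a - t • rankOneOp η ξ) : E →L[ℂ] E) =
      LinearMap.trace ℂ E (W ∘L a : E →L[ℂ] E) - t * ⟪ξ, W η⟫_ℂ := by
  have h : (W ∘L (a - t • rankOneOp η ξ) : E →L[ℂ] E) =
      W ∘L a - (t : ℂ) • (W ∘L rankOneOp η ξ) := by
    ext x
    simp
  rw [h, ContinuousLinearMap.toLinearMap_sub, ContinuousLinearMap.toLinearMap_smul, map_sub, map_smul,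
    trace_comp_rankOneOp, smul_eq_mul]

lemma traceNorm_sub_le_traceNorm_sub_smul_rankOneOp (a : E →L[ℂ] E) {t : ℝ} (ht : 0 ≤ t)
    {η ξ : E} (hη : ‖η‖ = 1) (hξ : ‖ξ‖ = 1) :
    traceNorm a - t ≤ traceNorm (a - t • rankOneOp η ξ) := by
  obtain ⟨W, hW⟩ := exists_traceNorm_eq_re_trace_comp a
  have h := re_trace_comp_le_traceNorm (W : E →L[ℂ] E) (a - t • rankOneOp η ξ)
    fun x => (W.norm_map x).le
  rw [trace_comp_sub_smul_rankOneOp, Complex.sub_re, ← hW, Complex.re_ofReal_mul] at h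
  have h1 : (⟪ξ, W η⟫_ℂ).re ≤ 1 := by
    simpa [hη, hξ] using (Complex.re_le_norm _).trans (norm_inner_le_norm ξ (W η))
  have h2 : t * (⟪ξ, W η⟫_ℂ).re ≤ t := mul_le_of_le_one_right ht h1
  change _ - t * (⟪ξ, W η⟫_ℂ).re ≤ _ at h
  linarith

lemma traceNorm_add_sub_le_traceNorm_sub_smul_rankOneOp (a : E →L[ℂ] E) (t : ℝ)
    {η ξ : E} (hη : ‖η‖ = 1) (hξ : ‖ξ‖ = 1) :
    traceNorm a + t - 2 * sValue a 0 ≤ traceNorm (a - t • rankOneOp η ξ) := by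
  rw [sValue_eq_singularValues, traceNorm_eq_sum_singularValues rfl a]
  set s := (a : E →ₗ[ℂ] E).singularValues with hs
  obtain ⟨u, v, huv⟩ :=
    LinearMap.exists_orthonormalBasis_apply_eq_singularValues_smul rfl (a : E →ₗ[ℂ] E)
  rw [← hs] at huv
  let U : E ≃ₗᵢ[ℂ] E := u.equiv v (Equiv.refl _)
  obtain ⟨w, c, hc0, hcw, hcontr, hmap⟩ :=
    exists_complex_reflection (x := ξ) (y := U η) (by rw [U.norm_map, hη, hξ])
  let R : E →L[ℂ] E := ContinuousLinearMap.id ℂ E - c • rankOneOp w w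
  have hR (z : E) : R z = z - (c * ⟪w, z⟫_ℂ) • w := by
    simp [R, rankOneOp_apply_s6, smul_smul]
  have h := re_trace_comp_le_traceNorm (R ∘L (U : E →L[ℂ] E)) (a - t • rankOneOp η ξ) fun x => by
    rw [ContinuousLinearMap.comp_apply, hR]
    exact (hcontr _).trans (U.norm_map x).le
  have hRU : (R ∘L (U : E →L[ℂ] E)) η = -ξ := (hR _).trans hmap
  have htr : (LinearMap.trace ℂ E ((R ∘L (U : E →L[ℂ] E)) ∘L a : E →L[ℂ] E)).re =
      ∑ i : Fin (finrank ℂ E), s i - c.re * ∑ i : Fin (finrank ℂ E), s i * ‖⟪w, v i⟫_ℂ‖ ^ 2 := by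
    rw [LinearMap.trace_eq_sum_inner _ v, Complex.re_sum, Finset.mul_sum, ← Finset.sum_sub_distrib]
    refine Finset.sum_congr rfl fun i _ => ?_
    have hai : a (v i) = (s i : ℂ) • u i := huv i
    have hUi : U (u i) = v i := by simp [U]
    have hRi : (R ∘L (U : E →L[ℂ] E)) (u i) = v i - (c * ⟪w, v i⟫_ℂ) • w := by
      rw [← hR, ← hUi]
      rfl
    rw [ContinuousLinearMap.coe_coe, ContinuousLinearMap.comp_apply, hai, map_smul, hRi,
      inner_smul_right, inner_sub_right, inner_smul_right, mul_assoc, ← inner_conj_symm (v i) w,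
      Complex.mul_conj, Complex.normSq_eq_norm_sq, Complex.re_ofReal_mul, Complex.sub_re,
      Complex.re_mul_ofReal, inner_self_eq_norm_sq_to_K, v.norm_eq_one]
    simp
    ring
  have hsum : ∑ i : Fin (finrank ℂ E), s i * ‖⟪w, v i⟫_ℂ‖ ^ 2 ≤ s 0 * ‖w‖ ^ 2 := by
    rw [← v.sum_sq_norm_inner_left w, Finset.mul_sum]
    refine Finset.sum_le_sum fun i _ => mul_le_mul_of_nonneg_right ?_ (by positivity)
    exact (a : E →ₗ[ℂ] E).singularValues_antitone (Nat.zero_le _)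
  have hs0 : 0 ≤ s 0 := (a : E →ₗ[ℂ] E).singularValues_nonneg 0
  rw [trace_comp_sub_smul_rankOneOp, Complex.sub_re, htr, Complex.re_ofReal_mul, hRU,
    inner_neg_right, inner_self_eq_norm_sq_to_K, hξ] at h
  have h3 := mul_le_mul_of_nonneg_left hsum hc0
  have h4 := mul_le_mul_of_nonneg_left hcw hs0
  simp at h
  linarith

lemma exists_traceNorm_sub_smul_rankOneOp_le (hn : 0 < finrank ℂ E) (a : E →L[ℂ] E) (t : ℝ) :
    ∃ η ξ : E, ‖η‖ = 1 ∧ ‖ξ‖ = 1 ∧ traceNorm (a - t • rankOneOp η ξ) ≤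
      |t - sValue a 0| + (traceNorm a - sValue a 0) := by
  classical
  rw [sValue_eq_singularValues, traceNorm_eq_sum_singularValues rfl a]
  set s := (a : E →ₗ[ℂ] E).singularValues with hs
  obtain ⟨u, v, huv⟩ :=
    LinearMap.exists_orthonormalBasis_apply_eq_singularValues_smul rfl (a : E →ₗ[ℂ] E)
  rw [← hs] at huv
  let z : Fin (finrank ℂ E) := ⟨0, hn⟩
  refine ⟨u z, v z, u.norm_eq_one z, v.norm_eq_one z, ?_⟩
  obtain ⟨W, hW⟩ := exists_traceNorm_eq_re_trace_comp (a - t • rankOneOp (u z) (v z))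
  have hdiag (i) : ((W : E →L[ℂ] E) ∘L (a - t • rankOneOp (u z) (v z))) (v i) =
      ((s i - if i = z then t else 0 : ℝ) : ℂ) • W (u i) := by
    have hai : a (v i) = (s i : ℂ) • u i := huv i
    rw [ContinuousLinearMap.comp_apply, sub_apply, smul_apply, rankOneOp_apply_s6,
      orthonormal_iff_ite.mp v.orthonormal, hai]
    by_cases hi : i = z
    · subst hi
      simp [sub_smul, -Complex.coe_smul, ← Complex.coe_smul t]
    · simp [hi, Ne.symm hi]
  rw [hW, LinearMap.trace_eq_sum_inner _ v, Complex.re_sum]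
  calc _ ≤ ∑ i : Fin (finrank ℂ E), |s i - if i = z then t else 0| := by
        refine Finset.sum_le_sum fun i _ => ?_
        have h1 : ‖⟪v i, W (u i)⟫_ℂ‖ ≤ 1 := by simpa using norm_inner_le_norm (v i) (W (u i))
        rw [ContinuousLinearMap.coe_coe, hdiag, inner_smul_right]
        refine (Complex.re_le_norm _).trans ?_
        rw [norm_mul, Complex.norm_real, Real.norm_eq_abs]
        exact mul_le_of_le_one_right (abs_nonneg _) h1
    _ = |t - s 0| + (∑ i : Fin (finrank ℂ E), s i - s 0) := by
        rw [← Finset.add_sum_erase _ _ (Finset.mem_univ z),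
          ← Finset.add_sum_erase _ (fun i : Fin (finrank ℂ E) => s i) (Finset.mem_univ z),
          if_pos rfl, abs_sub_comm, add_sub_cancel_left]
        congr 1
        refine Finset.sum_congr rfl fun i hi => ?_
        rw [if_neg (Finset.ne_of_mem_erase hi), sub_zero, abs_of_nonneg]
        exact (a : E →ₗ[ℂ] E).singularValues_nonneg i

end RankOne

/-- Let `H = ℂⁿ` be a finite-dimensional complex Hilbert space, let
`a ∈ C₁(H)` and let `t > 0`. Then the minimum over all minimal partial isometries `e` of
`f_{a,t}(e) = ‖a - t e‖₁` equals `|t - μ₁(a)| + (‖a‖₁ - μ₁(a))`, and this minimum is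
attained.  (Here `μ₁(a) = sValue a 0` is the largest singular value of `a`.) -/
theorem min_dist_to_multiples_of_min_partial_isometries_traceNorm (n : ℕ) (hn : 0 < n)
    (a : EuclideanSpace ℂ (Fin n) →L[ℂ] EuclideanSpace ℂ (Fin n)) (ha : MemTraceClass a)
    (t : ℝ) (ht : 0 < t) :
    IsLeast {r : ℝ | ∃ e : EuclideanSpace ℂ (Fin n) →L[ℂ] EuclideanSpace ℂ (Fin n),
        IsMinimalPartialIsometry e ∧ r = traceNorm (a - t • e)}
      (|t - sValue a 0| + (traceNorm a - sValue a 0)) := by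
  have hle : |t - sValue a 0| + (traceNorm a - sValue a 0) ∈ lowerBounds {r : ℝ |
      ∃ e : EuclideanSpace ℂ (Fin n) →L[ℂ] EuclideanSpace ℂ (Fin n),
        IsMinimalPartialIsometry e ∧ r = traceNorm (a - t • e)} := by
    rintro _ ⟨e, he, rfl⟩
    obtain ⟨η, ξ, hη, hξ, rfl⟩ := he.exists_eq_rankOneOp
    have h1 := traceNorm_sub_le_traceNorm_sub_smul_rankOneOp a ht.le hη hξ
    have h2 := traceNorm_add_sub_le_traceNorm_sub_smul_rankOneOp a t hη hξ
    rcases abs_cases (t - sValue a 0) with h | h <;> linarith [h.1]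
  obtain ⟨η, ξ, hη, hξ, h⟩ := exists_traceNorm_sub_smul_rankOneOp_le (by simpa using hn) a t
  have he := isMinimalPartialIsometry_rankOneOp hη hξ
  exact ⟨⟨_, he, (hle ⟨_, he, rfl⟩).antisymm h⟩, hle⟩
end
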